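/- arXiv:1702.06468 — 2 statements merged into one kernel-verified Lean document; each statement's English description precedes it below -/
import Mathlib

section
/- Let 0<Δ<1 and let y ∈ C²(B₁∖{0}; ℝ³) be Lipschitz on B₁ and satisfy (Dy)ᵀDy = g_Δ on B₁∖{0}. Then for every ρ ∈ (0,1), ∫_{∂B_ρ} |D²y(x)·x̂⊥|² dH¹(x) ≥ 2πΔ²/ρ, where D²y(x)·x̂⊥ ∈ ℝ³ˣ² denotes the contraction of the second derivative of y at x with the unit tangent x̂⊥ = (−x₂,x₁)/|x| in one slot. -/
open MeasureTheory Metric Real Filter Matrix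
open scoped ENNReal Topology

noncomputable section

/-- The plane `ℝ²` with the Euclidean norm. -/
abbrev E2 : Type := EuclideanSpace ℝ (Fin 2)
/-- The space `ℝ³` with the Euclidean norm. -/
abbrev E3 : Type := EuclideanSpace ℝ (Fin 3)

/-- The `i`-th standard basis vector of `ℝ²`. -/
def e2 (i : Fin 2) : E2 := EuclideanSpace.single i 1

/-- Partial derivative in the direction of the `i`-th coordinate. -/
def pd (i : Fin 2) (f : E2 → ℝ) (x : E2) : ℝ := fderiv ℝ f x (e2 i)

/-- Hessian matrix of a scalar function on `ℝ²`. -/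
def hess (f : E2 → ℝ) (x : E2) : Matrix (Fin 2) (Fin 2) ℝ :=
  Matrix.of fun i j => pd i (pd j f) x

/-- Derivative matrix `Dy ∈ ℝ^{3×2}` of a map `y : ℝ² → ℝ³`. -/
def Dmat (y : E2 → E3) (x : E2) : Matrix (Fin 3) (Fin 2) ℝ :=
  Matrix.of fun i j => pd j (fun z => y z i) x

/-- Induced metric `g_y = (Dy)ᵀ Dy`. -/
def gmet (y : E2 → E3) (x : E2) : Matrix (Fin 2) (Fin 2) ℝ :=
  (Dmat y x)ᵀ * Dmat y x

/-- The rotated vector `x⊥ = (-x₂, x₁)`. -/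
def perpVec (x : E2) : Fin 2 → ℝ := ![-(x 1), x 0]

/-- The unit tangent `x̂⊥ = (-x₂, x₁)/|x|`. -/
def xperpUnit (x : E2) : Fin 2 → ℝ := fun i => perpVec x i / ‖x‖

/-- The reference (cone) metric `g_Δ = Id - Δ² x̂⊥ ⊗ x̂⊥`. -/
def gDelta (Δ : ℝ) (x : E2) : Matrix (Fin 2) (Fin 2) ℝ :=
  1 - Matrix.of fun i j => (Δ ^ 2 / ‖x‖ ^ 2) * perpVec x i * perpVec x j

/-- Squared Frobenius norm of a matrix. -/
def frob2 {m n : Type*} [Fintype m] [Fintype n] (A : Matrix m n ℝ) : ℝ :=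
  ∑ i, ∑ j, (A i j) ^ 2

/-- `|D²y|²`: the sum of the squared Frobenius norms of the Hessians of the components. -/
def hessNormSq (y : E2 → E3) (x : E2) : ℝ :=
  ∑ i : Fin 3, frob2 (hess (fun z => y z i) x)

/-- The free elastic energy `I_{h,Δ}(y)`. -/
def energy (h Δ : ℝ) (y : E2 → E3) : ℝ :=
  ∫ x in ball (0 : E2) 1, (frob2 (gmet y x - gDelta Δ x) + h ^ 2 * hessNormSq y x)

/-- The singular cone `y^Δ(x) = √(1-Δ²)·(x,0) + Δ|x| e₃`. -/
def coneMap (Δ : ℝ) (x : E2) : E3 :=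
  (WithLp.equiv 2 (Fin 3 → ℝ)).symm
    ![Real.sqrt (1 - Δ ^ 2) * x 0, Real.sqrt (1 - Δ ^ 2) * x 1, Δ * ‖x‖]



theorem aux_wirtinger (g g' : ℝ → ℝ) (hg : ∀ x, HasDerivAt g (g' x) x) (hc : Continuous g')
    (hper : g (2 * π) = g 0) (hmean : ∫ x in (0:ℝ)..(2 * π), g x = 0) :
    ∫ x in (0:ℝ)..(2 * π), g x ^ 2 ≤ ∫ x in (0:ℝ)..(2 * π), g' x ^ 2 := by
  have hpi : (0:ℝ) < 2 * π := by positivity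
  have hgc : Continuous g := continuous_iff_continuousAt.2 fun x => (hg x).continuousAt
  have hL : ∀ f : ℝ → ℝ, Continuous f →
      MemLp (fun x => (f x : ℂ)) 2 (volume.restrict (Set.Ioc 0 (2 * π))) := by
    intro f hf
    have hfc : Continuous (fun x => (f x : ℂ)) := Complex.continuous_ofReal.comp hf
    obtain ⟨M, hM⟩ := (isCompact_Icc (a := (0:ℝ)) (b := 2 * π)).exists_bound_of_continuousOn
      hfc.continuousOn
    refine MemLp.of_bound hfc.aestronglyMeasurable M ?_
    exact (ae_restrict_iff' measurableSet_Ioc).2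
      (ae_of_all _ fun x hx => hM x (Set.Ioc_subset_Icc_self hx))
  have s1 := hasSum_sq_fourierCoeffOn hpi (hL g hgc)
  have s2 := hasSum_sq_fourierCoeffOn hpi (hL g' hc)
  have key := hasSum_le (fun n => ?_) s1 s2
  · simp only [Complex.norm_real, Real.norm_eq_abs, sq_abs, smul_eq_mul, sub_zero] at key
    exact le_of_mul_le_mul_left key (by positivity)
  · by_cases hn : n = 0
    · subst hn
      have : fourierCoeffOn hpi (fun x => (g x : ℂ)) 0 = 0 := by
        rw [fourierCoeffOn_eq_integral]
        simp [intervalIntegral.integral_ofReal, hmean]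
      rw [this]; simp
    · have h := fourierCoeffOn_of_hasDerivAt hpi (f := fun x => (g x : ℂ))
        (f' := fun x => (g' x : ℂ)) hn (fun x _ => (hg x).ofReal_comp)
        ((Complex.continuous_ofReal.comp hc).intervalIntegrable _ _)
      rw [hper, sub_self, mul_zero, zero_sub] at h
      have h2 : ‖fourierCoeffOn hpi (fun x => (g x : ℂ)) n‖ =
          ‖fourierCoeffOn hpi (fun x => (g' x : ℂ)) n‖ / |(n:ℝ)| := by
        rw [h]
        simp only [norm_mul, norm_neg, norm_div, Complex.norm_I, Complex.norm_real]
        simp [abs_of_pos pi_pos]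
        field_simp
      rw [h2]
      have h3 : (1:ℝ) ≤ |(n:ℝ)| := by
        have := Int.one_le_abs hn
        exact_mod_cast this
      gcongr
      exact div_le_self (norm_nonneg _) h3

/-- The circle parametrization. -/
def auxC (ρ θ : ℝ) : E2 := !₂[ρ * Real.cos θ, ρ * Real.sin θ]

theorem auxC_dist (ρ s t : ℝ) : dist (auxC ρ s) (auxC ρ t) ^ 2 =
    ρ ^ 2 * (2 - 2 * Real.cos (s - t)) := by
  rw [EuclideanSpace.dist_eq, Real.sq_sqrt (by positivity)]
  simp only [auxC, Fin.sum_univ_two, Real.dist_eq, sq_abs, Real.cos_sub]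
  simp
  nlinarith [Real.sin_sq_add_cos_sq s, Real.sin_sq_add_cos_sq t]

theorem auxC_cont (ρ : ℝ) : Continuous (auxC ρ) := by
  unfold auxC
  fun_prop

theorem auxC_norm (ρ : ℝ) (hρ : 0 ≤ ρ) (t : ℝ) : ‖auxC ρ t‖ = ρ := by
  rw [EuclideanSpace.norm_eq]
  simp [auxC]
  rw [Real.sqrt_eq_iff_mul_self_eq (by positivity) hρ]
  nlinarith [Real.sin_sq_add_cos_sq t]

theorem auxC_inj (ρ : ℝ) (hρ : 0 < ρ) : Set.InjOn (auxC ρ) (Set.Ico 0 (2 * π)) := by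
  intro s hs t ht h
  have h1 := auxC_dist ρ s t
  rw [h, dist_self] at h1
  have h2 : Real.cos (s - t) = 1 := by
    have : ρ ^ 2 ≠ 0 := by positivity
    have h3 : (2 - 2 * Real.cos (s - t)) = 0 := by
      by_contra h4
      exact (mul_ne_zero this h4) (by simpa using h1.symm)
    linarith
  have := (Real.cos_eq_one_iff_of_lt_of_lt (by linarith [hs.1, ht.2]) (by linarith [hs.2, ht.1])).1 h2
  linarith

theorem auxC_lip (ρ : ℝ) (hρ : 0 ≤ ρ) : LipschitzWith ⟨ρ, hρ⟩ (auxC ρ) := by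
  apply LipschitzWith.of_dist_le_mul
  intro s t
  apply le_of_sq_le_sq _ (by positivity)
  rw [auxC_dist, mul_pow, Real.dist_eq, sq_abs]
  have := Real.one_sub_sq_div_two_le_cos (x := s - t)
  show _ ≤ ρ ^ 2 * _
  apply mul_le_mul_of_nonneg_left _ (sq_nonneg _)
  linarith

theorem auxC_anti (ρ : ℝ) (hρ : 0 < ρ) (c : ℝ) (hc0 : 0 < c) (hc1 : c < 1) :
    ∃ δ > 0, ∀ s t : ℝ, |s - t| ≤ δ → c * ρ * dist s t ≤ dist (auxC ρ s) (auxC ρ t) := by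
  refine ⟨Real.sqrt (1 - c ^ 2), Real.sqrt_pos.2 (by nlinarith), ?_⟩
  intro s t hst
  have h0 : (0:ℝ) ≤ 1 - c ^ 2 := by nlinarith
  have h1 : (s - t) ^ 2 ≤ 1 - c ^ 2 := by
    rw [← sq_abs, ← Real.sq_sqrt h0]
    gcongr
  have h2 : |s - t| ≤ 1 := by
    rw [← sq_le_one_iff_abs_le_one]
    nlinarith
  have h3 := (abs_le.1 (Real.cos_bound h2)).2
  have h4 : |s - t| ^ 4 = (s-t)^2 * (s-t)^2 := by
    rw [show |s-t|^4 = (|s-t|^2)^2 by ring, sq_abs]; ring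
  rw [h4] at h3
  apply le_of_sq_le_sq _ dist_nonneg
  rw [auxC_dist, mul_pow, mul_pow, Real.dist_eq, sq_abs]
  have h5 : (s-t)^2 * (s-t)^2 ≤ (s-t)^2 * (1 - c^2) := by gcongr
  have h6 : c ^ 2 * (s-t)^2 ≤ 2 - 2 * Real.cos (s - t) := by
    nlinarith [sq_nonneg ((s-t)*(s-t))]
  calc c ^ 2 * ρ ^ 2 * (s - t) ^ 2 = ρ ^ 2 * (c ^ 2 * (s-t)^2) := by ring
    _ ≤ _ := by gcongr

theorem auxC_meas1 (ρ : ℝ) (hρ : 0 < ρ) (c : ℝ) (hc0 : 0 < c) (hc1 : c < 1) (B : Set ℝ)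
    (hB : MeasurableSet B) (hBs : B ⊆ Set.Ico 0 (2 * π)) :
    volume B ≤ ENNReal.ofReal (1 / (c * ρ)) * μH[1] (auxC ρ '' B) := by
  obtain ⟨δ, hδ, hanti⟩ := auxC_anti ρ hρ c hc0 hc1
  have hinj := auxC_inj ρ hρ
  set I : ℤ → Set ℝ := fun n => Set.Ico (n • δ) ((n + 1) • δ) with hI
  have hUI : ⋃ n, I n = Set.univ := iUnion_Ico_zsmul hδ
  have hdI : Pairwise (Function.onFun Disjoint I) := Set.pairwise_disjoint_Ico_zsmul δ
  have hBU : B = ⋃ n, B ∩ I n := by rw [← Set.inter_iUnion, hUI, Set.inter_univ]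
  have hBm : ∀ n, MeasurableSet (B ∩ I n) := fun n => hB.inter measurableSet_Ico
  have hBd : Pairwise (Function.onFun Disjoint fun n => B ∩ I n) := fun i j hij =>
    (hdI hij).mono Set.inter_subset_right Set.inter_subset_right
  have e1 : volume B = ∑' n, volume (B ∩ I n) := by
    conv_lhs => rw [hBU]
    exact measure_iUnion hBd hBm
  have e2 : μH[1] (auxC ρ '' B) = ∑' n, μH[1] (auxC ρ '' (B ∩ I n)) := by
    conv_lhs => rw [hBU, Set.image_iUnion]
    apply measure_iUnion
    · intro i j hij
      refine Set.disjoint_left.2 ?_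
      rintro _ ⟨s, hs, rfl⟩ ⟨t, ht, hst⟩
      have := hinj (hBs ht.1) (hBs hs.1) hst
      subst this
      exact Set.disjoint_left.1 (hBd hij) hs ht
    · intro n
      exact (hBm n).image_of_continuousOn_injOn (auxC_cont ρ).continuousOn
        (hinj.mono (Set.inter_subset_left.trans hBs))
  rw [e1, e2, ← ENNReal.tsum_mul_left]
  apply ENNReal.tsum_le_tsum
  intro n
  have hin : Set.InjOn (auxC ρ) (B ∩ I n) := hinj.mono (Set.inter_subset_left.trans hBs)
  have hleft := hin.leftInvOn_invFunOn
  set g := Function.invFunOn (auxC ρ) (B ∩ I n) with hg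
  have hlip : LipschitzOnWith (1 / (c * ρ)).toNNReal g (auxC ρ '' (B ∩ I n)) := by
    apply LipschitzOnWith.of_dist_le_mul
    rintro _ ⟨s, hs, rfl⟩ _ ⟨t, ht, rfl⟩
    rw [hleft hs, hleft ht, Real.coe_toNNReal _ (by positivity)]
    have := hanti s t (by
      have h1 := hs.2.1; have h2 := hs.2.2; have h3 := ht.2.1; have h4 := ht.2.2
      simp only [zsmul_eq_mul, Int.cast_add, Int.cast_one] at h1 h2 h3 h4
      rw [abs_le]; constructor <;> linarith)
    rw [div_mul_eq_mul_div, one_mul, le_div_iff₀ (by positivity)]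
    linarith
  have h := hlip.hausdorffMeasure_image_le (d := 1) zero_le_one
  rw [hleft.image_image, hausdorffMeasure_real, ENNReal.rpow_one] at h
  exact h

theorem auxC_meas2 (ρ : ℝ) (hρ : 0 < ρ) (B : Set ℝ)
    (hB : MeasurableSet B) (hBs : B ⊆ Set.Ico 0 (2 * π)) :
    ENNReal.ofReal ρ * volume B ≤ μH[1] (auxC ρ '' B) := by
  have h : volume B ≤ ENNReal.ofReal (1 / (1 * ρ)) * μH[1] (auxC ρ '' B) := by
    have ht : Tendsto (fun c : ℝ => ENNReal.ofReal (1 / (c * ρ)) * μH[1] (auxC ρ '' B)) (𝓝[<] 1)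
        (𝓝 (ENNReal.ofReal (1 / (1 * ρ)) * μH[1] (auxC ρ '' B))) := by
      apply ENNReal.Tendsto.mul_const
      · apply ENNReal.tendsto_ofReal
        have : ContinuousAt (fun c : ℝ => 1 / (c * ρ)) 1 := by
          apply ContinuousAt.div continuousAt_const (by fun_prop)
          simpa using hρ.ne'
        exact this.tendsto.mono_left nhdsWithin_le_nhds
      · left
        simpa using hρ
    refine ge_of_tendsto ht ?_
    filter_upwards [Ioo_mem_nhdsLT (show (0:ℝ) < 1 by norm_num)] with c hc
    exact auxC_meas1 ρ hρ c hc.1 hc.2 B hB hBs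
  calc _ ≤ ENNReal.ofReal ρ * (ENNReal.ofReal (1 / (1 * ρ)) * μH[1] (auxC ρ '' B)) := by gcongr
    _ = _ := by
      rw [← mul_assoc, ← ENNReal.ofReal_mul hρ.le, one_mul, mul_one_div_cancel hρ.ne']
      simp

theorem auxC_measure_le (ρ : ℝ) (hρ : 0 < ρ) :
    Measure.map (auxC ρ) (ENNReal.ofReal ρ • volume.restrict (Set.Ico 0 (2 * π))) ≤
      (μH[1] : Measure E2).restrict (sphere (0 : E2) ρ) := by
  rw [Measure.le_iff]
  intro A hA
  have hm := (auxC_cont ρ).measurable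
  rw [Measure.map_apply hm hA, Measure.restrict_apply hA, Measure.smul_apply,
    Measure.restrict_apply (hm hA), smul_eq_mul]
  refine (auxC_meas2 ρ hρ _ ((hm hA).inter measurableSet_Ico) Set.inter_subset_right).trans ?_
  apply measure_mono
  rintro _ ⟨s, hs, rfl⟩
  refine ⟨hs.1, ?_⟩
  simp [auxC_norm ρ hρ.le]

theorem auxC_surj (ρ : ℝ) (hρ : 0 < ρ) :
    sphere (0 : E2) ρ ⊆ auxC ρ '' Set.Icc (-π) π := by
  intro x hx
  have hn : ‖x‖ = ρ := by simpa using hx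
  set z : ℂ := ⟨x 0, x 1⟩ with hz
  have hzn : ‖z‖ = ρ := by
    rw [← hn, EuclideanSpace.norm_eq, Complex.norm_def, Complex.normSq_apply]
    simp [hz, Fin.sum_univ_two, sq]
  refine ⟨z.arg, ⟨(Complex.neg_pi_lt_arg z).le, Complex.arg_le_pi z⟩, ?_⟩
  ext i
  fin_cases i
  · simp [auxC, ← hzn, Complex.norm_mul_cos_arg, hz]
  · simp [auxC, ← hzn, Complex.norm_mul_sin_arg, hz]

theorem auxC_finite (ρ : ℝ) (hρ : 0 < ρ) : (μH[1] : Measure E2) (sphere (0 : E2) ρ) ≠ ⊤ := by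
  have h := (auxC_lip ρ hρ.le).hausdorffMeasure_image_le (d := 1) zero_le_one (Set.Icc (-π) π)
  have h1 := (measure_mono (auxC_surj ρ hρ)).trans h
  rw [hausdorffMeasure_real] at h1
  refine ne_top_of_le_ne_top ?_ h1
  rw [ENNReal.rpow_one]
  exact ENNReal.mul_ne_top ENNReal.coe_ne_top isCompact_Icc.measure_lt_top.ne

theorem auxC_integral (ρ : ℝ) (hρ : 0 < ρ) (f : E2 → ℝ) (hf : ∀ x, 0 ≤ f x)
    (hc : ContinuousOn f (sphere (0 : E2) ρ)) :
    ρ * ∫ θ in (0:ℝ)..(2 * π), f (auxC ρ θ) ≤ ∫ x in sphere (0 : E2) ρ, f x ∂μH[1] := by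
  have hms : MeasurableSet (sphere (0 : E2) ρ) := isClosed_sphere.measurableSet
  have hint : IntegrableOn f (sphere (0 : E2) ρ) μH[1] := by
    obtain ⟨M, hM⟩ := (isCompact_sphere (0 : E2) ρ).exists_bound_of_continuousOn hc
    refine ⟨?_, .restrict_of_bounded (C := M) (auxC_finite ρ hρ).lt_top ?_⟩
    · exact hc.aestronglyMeasurable hms
    · exact (ae_restrict_iff' hms).2 (ae_of_all _ hM)
  have hle := auxC_measure_le ρ hρ
  have h := integral_mono_measure hle (ae_of_all _ hf) hint
  rw [integral_map (auxC_cont ρ).aemeasurable (hint.1.mono_measure hle),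
    integral_smul_measure, ENNReal.toReal_ofReal hρ.le, smul_eq_mul,
    integral_Ico_eq_integral_Ioc, ← intervalIntegral.integral_of_le (by positivity)] at h
  exact h

theorem aux_fderiv_apply (f : E2 → ℝ) (x w : E2) :
    fderiv ℝ f x w = w 0 * pd 0 f x + w 1 * pd 1 f x := by
  have : w = w 0 • e2 0 + w 1 • e2 1 := by
    ext i; fin_cases i <;> simp [e2]
  conv_lhs => rw [this]
  simp [pd]

theorem aux_chain (f : E2 → ℝ) (c : ℝ → E2) (c' : E2) (t : ℝ) (hf : DifferentiableAt ℝ f (c t))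
    (hc : HasDerivAt c c' t) :
    HasDerivAt (fun s => f (c s)) (c' 0 * pd 0 f (c t) + c' 1 * pd 1 f (c t)) t := by
  rw [← aux_fderiv_apply]
  exact hf.hasFDerivAt.comp_hasDerivAt t hc

theorem aux_pd_contDiffOn {U : Set E2} (hU : IsOpen U) (f : E2 → ℝ) (m n : WithTop ℕ∞)
    (hf : ContDiffOn ℝ n f U) (hmn : m + 1 ≤ n) (j : Fin 2) : ContDiffOn ℝ m (pd j f) U :=
  (hf.fderiv_of_isOpen hU hmn).clm_apply contDiffOn_const

theorem aux_symm {U : Set E2} (hU : IsOpen U) (f : E2 → ℝ) (hf : ContDiffOn ℝ 2 f U) (x : E2)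
    (hx : x ∈ U) (i j : Fin 2) : pd i (pd j f) x = pd j (pd i f) x := by
  have hs : IsSymmSndFDerivAt ℝ f x :=
    (hf.contDiffAt (hU.mem_nhds hx)).isSymmSndFDerivAt (by simp)
  have hd : DifferentiableAt ℝ (fderiv ℝ f) x :=
    ((hf.fderiv_of_isOpen hU (m := 1) (by norm_num)).contDiffAt (hU.mem_nhds hx)).differentiableAt
      (by norm_num)
  have key : ∀ i j : Fin 2, pd i (pd j f) x = fderiv ℝ (fderiv ℝ f) x (e2 i) (e2 j) := by
    intro i j
    have : HasFDerivAt (pd j f) ((fderiv ℝ (fderiv ℝ f) x).flip (e2 j)) x := by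
      have := hd.hasFDerivAt.clm_apply (hasFDerivAt_const (e2 j) x)
      simp only [ContinuousLinearMap.comp_zero, zero_add] at this
      exact this
    show fderiv ℝ (pd j f) x (e2 i) = _
    rw [this.fderiv]; rfl
  rw [key, key, hs]

/-- Metric identities at a point. -/
theorem aux_metric (Δ : ℝ) (y : E2 → E3)
    (hiso : ∀ x ∈ ball (0 : E2) 1 \ {0}, gmet y x = gDelta Δ x) (x : E2)
    (hx : x ∈ ball (0 : E2) 1 \ {0}) (a b c d : ℝ) :
    ∑ i : Fin 3, (a * pd 0 (fun z => y z i) x + b * pd 1 (fun z => y z i) x) *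
      (c * pd 0 (fun z => y z i) x + d * pd 1 (fun z => y z i) x) =
    (a * c + b * d) - Δ ^ 2 / (x 0 ^ 2 + x 1 ^ 2) * (- x 1 * a + x 0 * b) *
      (- x 1 * c + x 0 * d) := by
  have h := hiso x hx
  have hn : ‖x‖ ^ 2 = x 0 ^ 2 + x 1 ^ 2 := by
    rw [EuclideanSpace.norm_eq, Real.sq_sqrt (by positivity)]; simp
  have h00 := congrFun (congrFun h 0) 0
  have h01 := congrFun (congrFun h 0) 1
  have h11 := congrFun (congrFun h 1) 1
  simp only [gmet, gDelta, Dmat, perpVec, Matrix.mul_apply, hn, Matrix.transpose_apply,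
    Matrix.of_apply, Matrix.sub_apply, Fin.sum_univ_three, Matrix.cons_val_zero,
    Matrix.cons_val_one, Matrix.one_apply_eq,
    Matrix.one_apply_ne (show (0 : Fin 2) ≠ 1 by decide)] at h00 h01 h11
  simp only [Fin.sum_univ_three]
  linear_combination a * c * h00 + (a * d + b * c) * h01 + b * d * h11

theorem aux_christoffel (Δ : ℝ) (y : E2 → E3)
    (hy : ContDiffOn ℝ 2 y (ball (0 : E2) 1 \ {0}))
    (hiso : ∀ x ∈ ball (0 : E2) 1 \ {0}, gmet y x = gDelta Δ x) (x : E2)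
    (hx : x ∈ ball (0 : E2) 1 \ {0}) :
    ∑ i : Fin 3, (x 1 ^ 2 * pd 0 (pd 0 fun z => y z i) x
        - 2 * x 0 * x 1 * pd 0 (pd 1 fun z => y z i) x
        + x 0 ^ 2 * pd 1 (pd 1 fun z => y z i) x) *
      (x 0 * pd 0 (fun z => y z i) x + x 1 * pd 1 (fun z => y z i) x) =
    Δ ^ 2 * (x 0 ^ 2 + x 1 ^ 2) := by
  have hU : IsOpen (ball (0 : E2) 1 \ {0}) := isOpen_ball.sdiff isClosed_singleton
  have hn : ‖x‖ ^ 2 = x 0 ^ 2 + x 1 ^ 2 := by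
    rw [EuclideanSpace.norm_eq, Real.sq_sqrt (by positivity)]; simp
  have hr : x 0 ^ 2 + x 1 ^ 2 ≠ 0 := by
    rw [← hn]
    have : x ≠ 0 := hx.2
    simpa using this
  have hf : ∀ i : Fin 3, ContDiffOn ℝ 2 (fun z => y z i) (ball (0 : E2) 1 \ {0}) := by
    intro i
    exact (contDiffOn_euclidean.1 hy) i
  have hpd : ∀ (i : Fin 3) (j : Fin 2), DifferentiableAt ℝ (pd j fun z => y z i) x := by
    intro i j
    exact ((aux_pd_contDiffOn hU _ 1 2 (hf i) (by norm_num) j).contDiffAt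
      (hU.mem_nhds hx)).differentiableAt (by norm_num)
  -- derivative along a line
  have hline : ∀ w : E2, HasDerivAt (fun t : ℝ => x + t • w) w 0 := by
    intro w
    simpa using ((hasDerivAt_id (0:ℝ)).smul_const w).const_add x
  have hP : ∀ (w : E2) (a b : ℝ) (i : Fin 3), HasDerivAt
      (fun t : ℝ => a * pd 0 (fun z => y z i) (x + t • w) + b * pd 1 (fun z => y z i) (x + t • w))
      (a * (w 0 * pd 0 (pd 0 fun z => y z i) x + w 1 * pd 1 (pd 0 fun z => y z i) x) +
       b * (w 0 * pd 0 (pd 1 fun z => y z i) x + w 1 * pd 1 (pd 1 fun z => y z i) x)) 0 := by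
    intro w a b i
    have h0 := aux_chain (pd 0 fun z => y z i) (fun t : ℝ => x + t • w) w 0
      (by simpa using hpd i 0) (hline w)
    have h1 := aux_chain (pd 1 fun z => y z i) (fun t : ℝ => x + t • w) w 0
      (by simpa using hpd i 1) (hline w)
    simp only [zero_smul, add_zero] at h0 h1
    exact (h0.const_mul a).add (h1.const_mul b)
  have hev : ∀ w : E2, ∀ᶠ t : ℝ in 𝓝 0, x + t • w ∈ ball (0 : E2) 1 \ {0} := by
    intro w
    have := (hline w).continuousAt
    apply this
    simpa using hU.mem_nhds hx
  set u : E2 := !₂[-x 1, x 0] with hu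
  -- first identity
  have i1 := HasDerivAt.fun_sum (u := Finset.univ) fun (i : Fin 3) _ =>
    (hP u (-x 1) (x 0) i).mul (hP u (x 0) (x 1) i)
  have i1' : HasDerivAt (fun t : ℝ => Δ ^ 2 * (x 0 ^ 2 + x 1 ^ 2) * (t / (1 + t ^ 2)))
      (Δ ^ 2 * (x 0 ^ 2 + x 1 ^ 2)) 0 := by
    have : HasDerivAt (fun t : ℝ => t / (1 + t ^ 2)) 1 0 := by
      have := (hasDerivAt_id (0:ℝ)).div (((hasDerivAt_id (0:ℝ)).pow 2).const_add 1) (by simp)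
      refine HasDerivAt.congr_deriv (f := fun t : ℝ => t / (1 + t ^ 2)) this ?_
      simp
    simpa using this.const_mul (Δ ^ 2 * (x 0 ^ 2 + x 1 ^ 2))
  have e1 := i1.unique (i1'.congr_of_eventuallyEq (by
    filter_upwards [hev u] with t ht
    have h := aux_metric Δ y hiso _ ht (-x 1) (x 0) (x 0) (x 1)
    simp only [Pi.mul_apply]
    rw [h]
    have h1 : (1 + t ^ 2) ≠ 0 := by positivity
    have h2 : (x + t • u) 0 ^ 2 + (x + t • u) 1 ^ 2 = (x 0 ^ 2 + x 1 ^ 2) * (1 + t ^ 2) := by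
      simp [hu]; ring
    rw [h2]
    simp [hu]
    field_simp
    ring))
  -- second identity
  have i2 := HasDerivAt.fun_sum (u := Finset.univ) fun (i : Fin 3) _ =>
    (hP x (-x 1) (x 0) i).mul (hP x (-x 1) (x 0) i)
  have i2' : HasDerivAt (fun t : ℝ => (1 - Δ ^ 2) * (x 0 ^ 2 + x 1 ^ 2)) 0 0 :=
    hasDerivAt_const _ _
  have e2 := i2.unique (i2'.congr_of_eventuallyEq (by
    filter_upwards [hev x, eventually_gt_nhds (show (-1:ℝ) < 0 by norm_num)] with t ht ht1
    have h := aux_metric Δ y hiso _ ht (-x 1) (x 0) (-x 1) (x 0)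
    simp only [Pi.mul_apply]
    rw [h]
    have h1 : (1 + t) ≠ 0 := by linarith
    have h2 : (x + t • x) 0 ^ 2 + (x + t • x) 1 ^ 2 = (x 0 ^ 2 + x 1 ^ 2) * (1 + t) ^ 2 := by
      simp; ring
    rw [h2]
    simp
    field_simp
    ring))
  have hs := fun i => aux_symm hU _ (hf i) x hx 1 0
  simp only [zero_smul, add_zero, hu, Fin.sum_univ_three, hs] at e1 e2 ⊢
  simp at e1 e2
  linear_combination e1 - e2 / 2

theorem stmt_13 (Δ : ℝ) (hΔ0 : 0 < Δ) (hΔ1 : Δ < 1) (y : E2 → E3)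
    (hy : ContDiffOn ℝ 2 y (ball (0 : E2) 1 \ {0}))
    (hlip : ∃ K : NNReal, LipschitzOnWith K y (ball (0 : E2) 1))
    (hiso : ∀ x ∈ ball (0 : E2) 1 \ {0}, gmet y x = gDelta Δ x) :
    ∀ ρ ∈ Set.Ioo (0 : ℝ) 1,
      2 * π * Δ ^ 2 / ρ ≤
        ∫ x in sphere (0 : E2) ρ,
          ∑ i : Fin 3, ∑ j : Fin 2,
            ((hess (fun z => y z i) x).mulVec (xperpUnit x) j) ^ 2 ∂μH[1] := by
  intro ρ hρ'
  obtain ⟨hρ, hρ1⟩ := hρ'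
  have hU : IsOpen (ball (0 : E2) 1 \ {0}) := isOpen_ball.sdiff isClosed_singleton
  have hf : ∀ i : Fin 3, ContDiffOn ℝ 2 (fun z => y z i) (ball (0 : E2) 1 \ {0}) :=
    fun i => (contDiffOn_euclidean.1 hy) i
  have hp1 : ∀ (i : Fin 3) (j : Fin 2),
      ContDiffOn ℝ 1 (pd j fun z => y z i) (ball (0 : E2) 1 \ {0}) :=
    fun i j => aux_pd_contDiffOn hU _ 1 2 (hf i) (by norm_num) j
  have hp2 : ∀ (i : Fin 3) (j k : Fin 2),
      ContinuousOn (pd k (pd j fun z => y z i)) (ball (0 : E2) 1 \ {0}) :=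
    fun i j k => (aux_pd_contDiffOn hU _ 0 1 (hp1 i j) (by norm_num) k).continuousOn
  have hsub : sphere (0 : E2) ρ ⊆ ball (0 : E2) 1 \ {0} := by
    intro x hx
    have hn : ‖x‖ = ρ := by simpa using hx
    refine ⟨by simpa [hn] using hρ1, ?_⟩
    rintro rfl
    simp at hn; exact hρ.ne hn
  have hγ : ∀ θ, auxC ρ θ ∈ sphere (0 : E2) ρ := fun θ => by simp [auxC_norm ρ hρ.le]
  have hγU : ∀ θ, auxC ρ θ ∈ ball (0 : E2) 1 \ {0} := fun θ => hsub (hγ θ)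
  have hγd : ∀ θ, HasDerivAt (auxC ρ) (!₂[-(ρ * Real.sin θ), ρ * Real.cos θ]) θ := by
    intro θ
    rw [hasDerivAt_iff_hasFDerivAt]
    apply HasStrictFDerivAt.hasFDerivAt
    rw [hasStrictFDerivAt_euclidean]
    intro i
    fin_cases i
    · refine HasStrictFDerivAt.congr_fderiv (f := fun s => ρ * Real.cos s)
        ((Real.hasStrictDerivAt_cos θ).const_mul ρ).hasStrictFDerivAt ?_
      ext; simp
    · refine HasStrictFDerivAt.congr_fderiv (f := fun s => ρ * Real.sin s)
        ((Real.hasStrictDerivAt_sin θ).const_mul ρ).hasStrictFDerivAt ?_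
      ext; simp
  have hγ0 : ∀ θ, auxC ρ θ 0 = ρ * Real.cos θ := fun θ => by simp [auxC]
  have hγ1 : ∀ θ, auxC ρ θ 1 = ρ * Real.sin θ := fun θ => by simp [auxC]
  have hγp : auxC ρ (2 * π) = auxC ρ 0 := by simp [auxC]
  -- the integrand is continuous on the sphere
  have hFc : ContinuousOn (fun x : E2 => ∑ i : Fin 3, ∑ j : Fin 2,
      ((hess (fun z => y z i) x).mulVec (xperpUnit x) j) ^ 2) (sphere (0 : E2) ρ) := by
    have hτ : ∀ k, ContinuousOn (fun x : E2 => xperpUnit x k) (sphere (0 : E2) ρ) := by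
      intro k
      unfold xperpUnit
      apply ContinuousOn.div
      · fin_cases k
        · simp [perpVec]; fun_prop
        · simp [perpVec]; fun_prop
      · fun_prop
      · intro x hx
        have hn : ‖x‖ = ρ := by simpa using hx
        rw [hn]; exact hρ.ne'
    refine continuousOn_finsetSum _ fun i _ => continuousOn_finsetSum _ fun j _ => ?_
    apply ContinuousOn.pow
    simp only [Matrix.mulVec, dotProduct]
    refine continuousOn_finsetSum _ fun k _ => ContinuousOn.mul ?_ (hτ k)
    exact (hp2 i k j).mono hsub
  refine le_trans ?_ (auxC_integral ρ hρ _ (fun x => by positivity) hFc)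
  set Q : Fin 3 → ℝ → ℝ := fun i θ =>
      ((auxC ρ θ) 1 ^ 2 * pd 0 (pd 0 fun z => y z i) (auxC ρ θ)
        - 2 * (auxC ρ θ) 0 * (auxC ρ θ) 1 * pd 0 (pd 1 fun z => y z i) (auxC ρ θ)
        + (auxC ρ θ) 0 ^ 2 * pd 1 (pd 1 fun z => y z i) (auxC ρ θ)) with hQ
  set R : Fin 3 → ℝ → ℝ := fun i θ =>
      ((auxC ρ θ) 0 * pd 0 (fun z => y z i) (auxC ρ θ)
        + (auxC ρ θ) 1 * pd 1 (fun z => y z i) (auxC ρ θ)) with hR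
  set G : Fin 3 → ℝ → ℝ := fun i θ =>
      (-(ρ * Real.sin θ) * pd 0 (fun z => y z i) (auxC ρ θ)
        + (ρ * Real.cos θ) * pd 1 (fun z => y z i) (auxC ρ θ)) with hG
  have hcomp : ∀ g : E2 → ℝ, ContinuousOn g (ball (0 : E2) 1 \ {0}) →
      Continuous fun θ => g (auxC ρ θ) := fun g hg => hg.comp_continuous (auxC_cont ρ) hγU
  have hQc : ∀ i, Continuous (Q i) := by
    intro i
    have h1 := hcomp _ (hp2 i 0 0)
    have h2 := hcomp _ (hp2 i 1 0)
    have h3 := hcomp _ (hp2 i 1 1)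
    simp only [hQ, hγ0, hγ1]
    fun_prop
  have hRc : ∀ i, Continuous (R i) := by
    intro i
    have h1 := hcomp _ (hp1 i 0).continuousOn
    have h2 := hcomp _ (hp1 i 1).continuousOn
    simp only [hR, hγ0, hγ1]
    fun_prop
  have hd1 : ∀ i θ, HasDerivAt (fun θ => y (auxC ρ θ) i) (G i θ) θ := by
    intro i θ
    have := aux_chain (fun z => y z i) (auxC ρ) _ θ
      (((hf i).contDiffAt (hU.mem_nhds (hγU θ))).differentiableAt (by norm_num)) (hγd θ)
    simpa [hG] using this
  have hd2 : ∀ i θ, HasDerivAt (G i) (Q i θ - R i θ) θ := by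
    intro i θ
    have hk := fun j => aux_chain (pd j fun z => y z i) (auxC ρ) _ θ
      (((hp1 i j).contDiffAt (hU.mem_nhds (hγU θ))).differentiableAt (by norm_num)) (hγd θ)
    have h0 := ((Real.hasDerivAt_sin θ).const_mul ρ).fun_neg.fun_mul (hk 0)
    have h1 := ((Real.hasDerivAt_cos θ).const_mul ρ).fun_mul (hk 1)
    have h := h0.fun_add h1
    refine h.congr_deriv ?_
    simp only [hQ, hR, hγ0, hγ1, aux_symm hU _ (hf i) _ (hγU θ) 1 0]
    simp
    ring
  have hGc : ∀ i, Continuous (G i) := fun i =>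
    continuous_iff_continuousAt.2 fun θ => (hd2 i θ).continuousAt
  have hW : ∀ i, ∫ θ in (0:ℝ)..(2 * π), G i θ ^ 2 ≤
      ∫ θ in (0:ℝ)..(2 * π), (Q i θ - R i θ) ^ 2 := by
    intro i
    refine aux_wirtinger (G i) (fun θ => Q i θ - R i θ) (hd2 i) ((hQc i).sub (hRc i)) ?_ ?_
    · simp [hG, hγp]
    · rw [intervalIntegral.integral_eq_sub_of_hasDerivAt (fun θ _ => hd1 i θ)
        ((hGc i).intervalIntegrable _ _), hγp, sub_self]
  have hsq : ∀ θ, (auxC ρ θ) 0 ^ 2 + (auxC ρ θ) 1 ^ 2 = ρ ^ 2 := by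
    intro θ
    rw [hγ0, hγ1]
    nlinarith [Real.sin_sq_add_cos_sq θ]
  have hGs : ∀ θ, ∑ i, G i θ ^ 2 = (1 - Δ ^ 2) * ρ ^ 2 := by
    intro θ
    have h := aux_metric Δ y hiso _ (hγU θ) (-(ρ * Real.sin θ)) (ρ * Real.cos θ)
      (-(ρ * Real.sin θ)) (ρ * Real.cos θ)
    simp only [← sq] at h
    rw [hsq, hγ0, hγ1] at h
    simp only [hG]
    rw [h]
    field_simp
    have := Real.sin_sq_add_cos_sq θ
    rw [Real.sin_sq]
    ring
  have hRs : ∀ θ, ∑ i, R i θ ^ 2 = ρ ^ 2 := by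
    intro θ
    have h := aux_metric Δ y hiso _ (hγU θ) ((auxC ρ θ) 0) ((auxC ρ θ) 1)
      ((auxC ρ θ) 0) ((auxC ρ θ) 1)
    simp only [← sq] at h
    rw [hsq] at h
    simp only [hR]
    rw [h]
    ring
  have hQR : ∀ θ, ∑ i, Q i θ * R i θ = Δ ^ 2 * ρ ^ 2 := by
    intro θ
    rw [← hsq θ]
    exact aux_christoffel Δ y hy hiso _ (hγU θ)
  have hsum : ∀ θ, ∑ i, (Q i θ - R i θ) ^ 2 = ∑ i, Q i θ ^ 2 - 2 * (Δ ^ 2 * ρ ^ 2) + ρ ^ 2 := by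
    intro θ
    rw [← hQR θ, ← hRs θ]
    simp only [Fin.sum_univ_three]
    ring
  have hI1 : 2 * π * ((1 - Δ ^ 2) * ρ ^ 2) ≤
      ∫ θ in (0:ℝ)..(2 * π), (∑ i, Q i θ ^ 2 - 2 * (Δ ^ 2 * ρ ^ 2) + ρ ^ 2) := by
    calc 2 * π * ((1 - Δ ^ 2) * ρ ^ 2) = ∫ θ in (0:ℝ)..(2 * π), ∑ i, G i θ ^ 2 := by
          simp only [hGs]; simp; ring
      _ = ∑ i, ∫ θ in (0:ℝ)..(2 * π), G i θ ^ 2 :=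
          intervalIntegral.integral_finsetSum fun i _ =>
            ((hGc i).pow 2).intervalIntegrable _ _
      _ ≤ ∑ i, ∫ θ in (0:ℝ)..(2 * π), (Q i θ - R i θ) ^ 2 := Finset.sum_le_sum fun i _ => hW i
      _ = ∫ θ in (0:ℝ)..(2 * π), ∑ i, (Q i θ - R i θ) ^ 2 :=
          (intervalIntegral.integral_finsetSum fun i _ =>
            (((hQc i).sub (hRc i)).pow 2).intervalIntegrable _ _).symm
      _ = _ := by simp only [hsum]
  have hQsc : Continuous fun θ => ∑ i, Q i θ ^ 2 :=
    continuous_finsetSum _ fun i _ => (hQc i).pow 2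
  have hI2 : ∫ θ in (0:ℝ)..(2 * π), (∑ i, Q i θ ^ 2 - 2 * (Δ ^ 2 * ρ ^ 2) + ρ ^ 2) =
      (∫ θ in (0:ℝ)..(2 * π), ∑ i, Q i θ ^ 2) + 2 * π * (ρ ^ 2 - 2 * (Δ ^ 2 * ρ ^ 2)) := by
    have e : ∀ θ, ∑ i, Q i θ ^ 2 - 2 * (Δ ^ 2 * ρ ^ 2) + ρ ^ 2 =
      ∑ i, Q i θ ^ 2 + (ρ ^ 2 - 2 * (Δ ^ 2 * ρ ^ 2)) := fun θ => by ring
    simp only [e]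
    rw [intervalIntegral.integral_add (hQsc.intervalIntegrable _ _)
      (continuous_const.intervalIntegrable _ _)]
    simp
    ring
  have hI3 : 2 * π * (Δ ^ 2 * ρ ^ 2) ≤ ∫ θ in (0:ℝ)..(2 * π), ∑ i, Q i θ ^ 2 := by
    rw [hI2] at hI1
    linarith
  have hpt : ∀ θ, (1 / ρ ^ 4) * ∑ i, Q i θ ^ 2 ≤ ∑ i : Fin 3, ∑ j : Fin 2,
      ((hess (fun z => y z i) (auxC ρ θ)).mulVec (xperpUnit (auxC ρ θ)) j) ^ 2 := by
    intro θ
    rw [Finset.mul_sum]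
    refine Finset.sum_le_sum fun i _ => ?_
    have hs := aux_symm hU _ (hf i) _ (hγU θ) 1 0
    simp only [hQ, Fin.sum_univ_two, Matrix.mulVec, dotProduct, hess, Matrix.of_apply, xperpUnit,
      auxC_norm ρ hρ.le, perpVec, Matrix.cons_val_zero, Matrix.cons_val_one, hs]
    have h2 := hsq θ
    generalize pd 0 (pd 0 fun z => y z i) (auxC ρ θ) = A
    generalize pd 0 (pd 1 fun z => y z i) (auxC ρ θ) = B
    generalize pd 1 (pd 1 fun z => y z i) (auxC ρ θ) = C
    generalize (auxC ρ θ) 0 = p at *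
    generalize (auxC ρ θ) 1 = q at *
    have e1 : (A * (-q / ρ) + B * (p / ρ)) ^ 2 + (B * (-q / ρ) + C * (p / ρ)) ^ 2 =
      (1 / ρ ^ 4) * (ρ ^ 2 * ((A * (-q) + B * p) ^ 2 + (B * (-q) + C * p) ^ 2)) := by
      field_simp
    rw [e1, ← h2]
    gcongr
    nlinarith [sq_nonneg ((A * (-q) + B * p) * p + (B * (-q) + C * p) * q)]
  have hI4 : (1 / ρ ^ 4) * ∫ θ in (0:ℝ)..(2 * π), ∑ i, Q i θ ^ 2 ≤
      ∫ θ in (0:ℝ)..(2 * π), ∑ i : Fin 3, ∑ j : Fin 2,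
      ((hess (fun z => y z i) (auxC ρ θ)).mulVec (xperpUnit (auxC ρ θ)) j) ^ 2 := by
    rw [← intervalIntegral.integral_const_mul]
    refine intervalIntegral.integral_mono (by positivity)
      ((continuous_const.mul hQsc).intervalIntegrable _ _)
      ((hFc.comp_continuous (auxC_cont ρ) hγ).intervalIntegrable _ _) hpt
  calc 2 * π * Δ ^ 2 / ρ = ρ * ((1 / ρ ^ 4) * (2 * π * (Δ ^ 2 * ρ ^ 2))) := by
        field_simp
    _ ≤ ρ * ((1 / ρ ^ 4) * ∫ θ in (0:ℝ)..(2 * π), ∑ i, Q i θ ^ 2) := by gcongr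
    _ ≤ _ := by gcongr
end
end

section
/- Let 0<Δ<1 and let y ∈ C²(cl(B₁)∖{0}; ℝ³) be positively 1-homogeneous (y(tx) = t·y(x) for t>0 where defined) with (Dy)ᵀDy = g_Δ, and suppose there is a constant C such that ∫_{B₁∖B_ρ} |D²y|² dL² ≤ 2πΔ² log(1/ρ) + C for every ρ ∈ (0,1). Then there exist R ∈ O(3) and b ∈ ℝ³ such that y(x) = R·y^Δ(x) + b for all x, where y^Δ(x) = √(1−Δ²)·(x,0) + Δ|x| e₃. -/
open MeasureTheory Metric Real Filter Matrix
open scoped ENNReal Topology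

noncomputable section

def ev (r t : ℝ) : E2 := !₂[r * cos t, r * sin t]

@[simp] lemma ev_zero (r t : ℝ) : ev r t 0 = r * cos t := rfl
@[simp] lemma ev_one (r t : ℝ) : ev r t 1 = r * sin t := rfl

lemma ev_smul (r t : ℝ) : ev r t = r • ev 1 t := by
  ext i; fin_cases i <;> simp [ev]

lemma ev_norm (r t : ℝ) (hr : 0 ≤ r) : ‖ev r t‖ = r := by
  rw [EuclideanSpace.norm_eq]
  simp only [Fin.sum_univ_two, ev_zero, ev_one, Real.norm_eq_abs, sq_abs]
  rw [show (r * cos t)^2 + (r * sin t)^2 = r^2 by linear_combination r^2 * sin_sq_add_cos_sq t]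
  exact Real.sqrt_sq hr

lemma ev_ne (r t : ℝ) (hr : 0 < r) : ev r t ≠ 0 := by
  intro h
  have := ev_norm r t hr.le
  rw [h] at this; simp at this; linarith

lemma ev_cont : Continuous (fun p : ℝ × ℝ => ev p.1 p.2) := by
  unfold ev
  fun_prop

lemma fd_eq (h : E2 → ℝ) (x v : E2) : fderiv ℝ h x v = v 0 * pd 0 h x + v 1 * pd 1 h x := by
  have : v = v 0 • e2 0 + v 1 • e2 1 := by
    ext i; fin_cases i <;> simp [e2]
  conv_lhs => rw [this]
  simp [pd]

lemma ev_hasDeriv (r t : ℝ) : HasDerivAt (fun t => ev r t) (!₂[-(r * sin t), r * cos t] : E2) t := by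
  have h := (((hasDerivAt_cos t).const_mul r).smul_const (e2 0)).add
    (((hasDerivAt_sin t).const_mul r).smul_const (e2 1))
  have e1 : (fun t => ev r t) = (fun t => (r * cos t) • e2 0) + (fun t => (r * sin t) • e2 1) := by
    funext t; ext i; fin_cases i <;> simp [ev, e2]
  rw [e1]
  refine h.congr_deriv ?_
  ext i; fin_cases i <;> simp [e2]

lemma chain (h : E2 → ℝ) (r t : ℝ) (hd : DifferentiableAt ℝ h (ev r t)) :
    HasDerivAt (fun t => h (ev r t))
      (-(r * sin t) * pd 0 h (ev r t) + (r * cos t) * pd 1 h (ev r t)) t := by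
  have := hd.hasFDerivAt.comp_hasDerivAt t (ev_hasDeriv r t)
  rw [fd_eq] at this
  exact this

def D1 (f : E2 → ℝ) (r t : ℝ) : ℝ :=
  -(r * sin t) * pd 0 f (ev r t) + (r * cos t) * pd 1 f (ev r t)

def Q (f : E2 → ℝ) (r t : ℝ) : ℝ :=
  sin t ^ 2 * hess f (ev r t) 0 0 - sin t * cos t * (hess f (ev r t) 0 1 + hess f (ev r t) 1 0)
    + cos t ^ 2 * hess f (ev r t) 1 1

def D2 (f : E2 → ℝ) (r t : ℝ) : ℝ := - f (ev r t) + r ^ 2 * Q f r t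

section scalar
variable (f : E2 → ℝ) (hf : ContDiffOn ℝ 2 f {(0 : E2)}ᶜ)
  (hom : ∀ t : ℝ, 0 < t → ∀ x : E2, x ≠ 0 → f (t • x) = t * f x)

lemma c0_open : IsOpen ({(0 : E2)}ᶜ : Set E2) := isOpen_compl_singleton

lemma f_diff (hf : ContDiffOn ℝ 2 f {(0 : E2)}ᶜ) (x : E2) (hx : x ≠ 0) : DifferentiableAt ℝ f x :=
  (hf.contDiffAt (c0_open.mem_nhds hx)).differentiableAt (by norm_num)

lemma pd_cd (hf : ContDiffOn ℝ 2 f {(0 : E2)}ᶜ) (j : Fin 2) : ContDiffOn ℝ 1 (pd j f) {(0 : E2)}ᶜ := by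
  have := hf.fderiv_of_isOpen c0_open (m := 1) (by norm_num)
  exact this.clm_apply contDiffOn_const

lemma pd_diff (hf : ContDiffOn ℝ 2 f {(0 : E2)}ᶜ) (j : Fin 2) (x : E2) (hx : x ≠ 0) :
    DifferentiableAt ℝ (pd j f) x :=
  ((pd_cd f hf j).contDiffAt (c0_open.mem_nhds hx)).differentiableAt (by norm_num)

lemma hess_cont (hf : ContDiffOn ℝ 2 f {(0 : E2)}ᶜ) (i j : Fin 2) :
    ContinuousOn (fun x => hess f x i j) {(0 : E2)}ᶜ := by
  have := (pd_cd f hf j).fderiv_of_isOpen c0_open (m := 0) (by norm_num)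
  exact (this.clm_apply (contDiffOn_const (c := e2 i))).continuousOn

lemma euler (hf : ContDiffOn ℝ 2 f {(0 : E2)}ᶜ)
    (hom : ∀ t : ℝ, 0 < t → ∀ x : E2, x ≠ 0 → f (t • x) = t * f x) (x : E2) (hx : x ≠ 0) :
    x 0 * pd 0 f x + x 1 * pd 1 f x = f x := by
  rw [← fd_eq]
  have h1 : HasDerivAt (fun t : ℝ => t • x) x 1 := by
    simpa using (hasDerivAt_id (1:ℝ)).smul_const x
  have h2 : HasDerivAt (fun t : ℝ => f (t • x)) (fderiv ℝ f x x) 1 := by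
    have hd : HasFDerivAt f (fderiv ℝ f x) ((1:ℝ) • x) := by
      rw [one_smul]; exact (f_diff f hf x hx).hasFDerivAt
    exact hd.comp_hasDerivAt (1:ℝ) h1
  have h3 : HasDerivAt (fun t : ℝ => t * f x) (f x) 1 := by
    simpa using (hasDerivAt_id (1:ℝ)).mul_const (f x)
  have h4 : (fun t : ℝ => f (t • x)) =ᶠ[𝓝 1] fun t => t * f x := by
    filter_upwards [lt_mem_nhds (zero_lt_one' ℝ)] with t ht
    exact hom t ht x hx
  exact h2.unique (h3.congr_of_eventuallyEq h4)

lemma hD1 (hf : ContDiffOn ℝ 2 f {(0 : E2)}ᶜ) (r t : ℝ) (hr : 0 < r) :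
    HasDerivAt (fun t => f (ev r t)) (D1 f r t) t :=
  chain f r t (f_diff f hf _ (ev_ne r t hr))

lemma hD2 (hf : ContDiffOn ℝ 2 f {(0 : E2)}ᶜ)
    (hom : ∀ t : ℝ, 0 < t → ∀ x : E2, x ≠ 0 → f (t • x) = t * f x) (r t : ℝ) (hr : 0 < r) :
    HasDerivAt (fun t => D1 f r t) (D2 f r t) t := by
  have k0 := chain (pd 0 f) r t (pd_diff f hf 0 _ (ev_ne r t hr))
  have k1 := chain (pd 1 f) r t (pd_diff f hf 1 _ (ev_ne r t hr))
  have := ((((hasDerivAt_sin t).const_mul r).neg).mul k0).add (((hasDerivAt_cos t).const_mul r).mul k1)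
  have e := euler f hf hom _ (ev_ne r t hr)
  rw [ev_zero, ev_one] at e
  refine this.congr_deriv ?_
  simp only [D2, Q, hess, Matrix.of_apply, Pi.neg_apply]
  rw [← e]
  ring

lemma hom_ev (hom : ∀ t : ℝ, 0 < t → ∀ x : E2, x ≠ 0 → f (t • x) = t * f x) (r t : ℝ) (hr : 0 < r) :
    f (ev r t) = r * f (ev 1 t) := by
  rw [ev_smul, hom r hr _ (ev_ne 1 t one_pos)]

lemma D1_hom (hf : ContDiffOn ℝ 2 f {(0 : E2)}ᶜ)
    (hom : ∀ t : ℝ, 0 < t → ∀ x : E2, x ≠ 0 → f (t • x) = t * f x) (r t : ℝ) (hr : 0 < r) :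
    D1 f r t = r * D1 f 1 t := by
  have h1 := hD1 f hf r t hr
  have h2 := (hD1 f hf 1 t one_pos).const_mul r
  rw [show (fun t => f (ev r t)) = fun t => r * f (ev 1 t) from funext fun t => hom_ev f hom r t hr] at h1
  exact h1.unique h2

lemma D2_hom (hf : ContDiffOn ℝ 2 f {(0 : E2)}ᶜ)
    (hom : ∀ t : ℝ, 0 < t → ∀ x : E2, x ≠ 0 → f (t • x) = t * f x) (r t : ℝ) (hr : 0 < r) :
    D2 f r t = r * D2 f 1 t := by
  have h1 := hD2 f hf hom r t hr
  have h2 := (hD2 f hf hom 1 t one_pos).const_mul r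
  rw [show (fun t => D1 f r t) = fun t => r * D1 f 1 t from funext fun t => D1_hom f hf hom r t hr] at h1
  exact h1.unique h2

lemma Q_bound (r t : ℝ) : Q f r t ^ 2 ≤ frob2 (hess f (ev r t)) := by
  simp only [frob2, Fin.sum_univ_two, Q]
  generalize hess f (ev r t) 0 0 = a
  generalize hess f (ev r t) 0 1 = b
  generalize hess f (ev r t) 1 0 = c
  generalize hess f (ev r t) 1 1 = d
  have h := sin_sq_add_cos_sq t
  generalize sin t = s at *
  generalize cos t = k at *
  have e : a^2 + b^2 + (c^2+d^2) - (s^2*a - s*k*(b+c)+k^2*d)^2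
    = (s^2*b + s*k*a)^2 + (s^2*c+s*k*a)^2 + (s^2*d-k^2*a)^2 + (s*k*b-s*k*c)^2 + (s*k*d+k^2*b)^2 + (s*k*d+k^2*c)^2 := by
    have : (s^2+k^2)^2 = 1 := by rw [h]; ring
    linear_combination (-(a^2+b^2+c^2+d^2)) * this
  nlinarith [sq_nonneg (s^2*b + s*k*a), sq_nonneg (s^2*c+s*k*a), sq_nonneg (s^2*d-k^2*a), sq_nonneg (s*k*b-s*k*c), sq_nonneg (s*k*d+k^2*b), sq_nonneg (s*k*d+k^2*c)]

lemma key_bound (hf : ContDiffOn ℝ 2 f {(0 : E2)}ᶜ)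
    (hom : ∀ t : ℝ, 0 < t → ∀ x : E2, x ≠ 0 → f (t • x) = t * f x) (r t : ℝ) (hr : 0 < r) :
    (f (ev 1 t) + D2 f 1 t) ^ 2 / r ≤ r * frob2 (hess f (ev r t)) := by
  have h1 := D2_hom f hf hom r t hr
  have h2 := hom_ev f hom r t hr
  have h3 : f (ev 1 t) + D2 f 1 t = r * Q f r t := by
    apply mul_left_cancel₀ hr.ne'
    rw [mul_add, ← h1, ← h2]; simp only [D2]; ring
  rw [h3, div_le_iff₀ hr]
  nlinarith [Q_bound f r t, sq_nonneg r]

lemma D2_cont (hf : ContDiffOn ℝ 2 f {(0 : E2)}ᶜ) : Continuous (D2 f 1) := by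
  have hev : Continuous (ev 1) := ev_cont.comp (Continuous.prodMk_right 1)
  have hm : ∀ t, ev 1 t ∈ ({(0 : E2)}ᶜ : Set E2) := fun t => ev_ne 1 t one_pos
  have h1 := fun i j => (hess_cont f hf i j).comp_continuous hev hm
  have h2 := hf.continuousOn.comp_continuous hev hm
  have e : D2 f 1 = fun t => -((f ∘ ev 1) t) + 1 ^ 2 * (sin t ^ 2 * (fun t => hess f (ev 1 t) 0 0) t
      - sin t * cos t * ((fun t => hess f (ev 1 t) 0 1) t + (fun t => hess f (ev 1 t) 1 0) t)
      + cos t ^ 2 * (fun t => hess f (ev 1 t) 1 1) t) := rfl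
  have k0 := h1 0 0
  have k1 := h1 0 1
  have k2 := h1 1 0
  have k3 := h1 1 1
  rw [e]
  exact (h2.neg).add (continuous_const.mul
    ((((continuous_sin.pow 2).mul k0).sub ((continuous_sin.mul continuous_cos).mul (k1.add k2))).add
      ((continuous_cos.pow 2).mul k3)))

end scalar

lemma polar_bound (h : E2 → ℝ) (hh : ContinuousOn h {(0 : E2)}ᶜ) (G : ℝ → ℝ) (hG : Continuous G)
    (hle : ∀ r t : ℝ, 0 < r → G t / r ≤ r * h (ev r t)) (ρ : ℝ) (hρ : ρ ∈ Set.Ioo (0:ℝ) 1) :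
    Real.log (1 / ρ) * ∫ t in (-π)..π, G t ≤ ∫ x in ball (0 : E2) 1 \ ball 0 ρ, h x := by
  obtain ⟨h0, h1⟩ := hρ
  set A : Set E2 := ball (0 : E2) 1 \ ball 0 ρ with hA
  have mA : MeasurableSet A := measurableSet_ball.diff measurableSet_ball
  set S : Set (ℝ × ℝ) := Set.Ico ρ 1 ×ˢ Set.Ioo (-π) π with hS
  have mS : MeasurableSet S := measurableSet_Ico.prod measurableSet_Ioo
  have e1 : ∫ x in A, h x = ∫ p in S, p.1 * h (ev p.1 p.2) := by
    rw [← integral_indicator mA,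
      ← (Complex.orthonormalBasisOneI.measurePreserving_repr).integral_comp
        (Complex.orthonormalBasisOneI.repr.toHomeomorph.measurableEmbedding),
      ← Complex.integral_comp_polarCoord_symm, polarCoord_target]
    have : Set.EqOn (fun p : ℝ × ℝ => p.1 • A.indicator h
        (Complex.orthonormalBasisOneI.repr (Complex.polarCoord.symm p)))
        (S.indicator fun p => p.1 * h (ev p.1 p.2)) (Set.Ioi 0 ×ˢ Set.Ioo (-π) π) := by
      rintro ⟨r, t⟩ ⟨hr, ht⟩
      simp only [Set.mem_Ioi] at hr ht
      have e : Complex.orthonormalBasisOneI.repr (Complex.polarCoord.symm (r, t)) = ev r t := by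
        ext i
        rw [Complex.polarCoord_symm_apply]
        fin_cases i <;> simp [ev, Complex.cos_ofReal_re, Complex.sin_ofReal_re, -Complex.ofReal_cos, -Complex.ofReal_sin]
      simp only [e]
      have hm : ev r t ∈ A ↔ (r, t) ∈ S := by
        simp only [hA, hS, Set.mem_sdiff, mem_ball_zero_iff, ev_norm r t hr.le, Set.mem_prod, Set.mem_Ico, not_lt]
        tauto
      by_cases hx : ev r t ∈ A
      · rw [Set.indicator_of_mem hx, Set.indicator_of_mem (hm.1 hx)]; rfl
      · rw [Set.indicator_of_notMem hx, Set.indicator_of_notMem (fun h => hx (hm.2 h))]; simp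
    rw [setIntegral_congr_fun (measurableSet_Ioi.prod measurableSet_Ioo) this,
      setIntegral_indicator mS]
    congr 2
    apply Set.inter_eq_right.2
    rintro ⟨r, t⟩ ⟨hr, ht⟩
    exact ⟨lt_of_lt_of_le h0 hr.1, ht⟩
  have sub : S ⊆ Set.Icc ρ 1 ×ˢ Set.Icc (-π) π :=
    Set.prod_mono Set.Ico_subset_Icc_self Set.Ioo_subset_Icc_self
  have cpt : IsCompact (Set.Icc ρ 1 ×ˢ Set.Icc (-π) π) := isCompact_Icc.prod isCompact_Icc
  have i1 : IntegrableOn (fun p : ℝ × ℝ => p.1 * h (ev p.1 p.2)) S := by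
    refine IntegrableOn.mono_set (ContinuousOn.integrableOn_compact cpt ?_) sub
    refine continuousOn_fst.mul (hh.comp ev_cont.continuousOn ?_)
    rintro ⟨r, t⟩ ⟨hr, ht⟩
    exact ev_ne r t (lt_of_lt_of_le h0 hr.1)
  have i2 : IntegrableOn (fun p : ℝ × ℝ => p.1⁻¹ * G p.2) S := by
    refine IntegrableOn.mono_set (ContinuousOn.integrableOn_compact cpt ?_) sub
    refine (continuousOn_fst.inv₀ ?_).mul (hG.comp continuous_snd).continuousOn
    rintro ⟨r, t⟩ ⟨hr, ht⟩
    exact (lt_of_lt_of_le h0 hr.1).ne'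
  have e2 : ∫ p in S, p.1⁻¹ * G p.2 = Real.log (1 / ρ) * ∫ t in (-π)..π, G t := by
    rw [hS, Measure.volume_eq_prod, setIntegral_prod_mul (fun r : ℝ => r⁻¹) G]
    congr 1
    · rw [integral_Ico_eq_integral_Ioc, ← intervalIntegral.integral_of_le h1.le,
        integral_inv_of_pos h0 one_pos]
    · rw [intervalIntegral.integral_of_le (by linarith [Real.pi_pos]), integral_Ioc_eq_integral_Ioo]
  rw [← e2, e1]
  refine setIntegral_mono_on i2 i1 mS ?_
  rintro ⟨r, t⟩ ⟨hr, ht⟩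
  have := hle r t (lt_of_lt_of_le h0 hr.1)
  rwa [div_eq_inv_mul] at this

lemma log_bound (K D C : ℝ) (h : ∀ ρ ∈ Set.Ioo (0:ℝ) 1, Real.log (1/ρ) * K ≤ D * Real.log (1/ρ) + C) :
    K ≤ D := by
  by_contra! hlt
  have hp : 0 < K - D := by linarith
  set L := (|C| + 1) / (K - D)
  have hL : 0 < L := by positivity
  have := h (Real.exp (-L)) ⟨Real.exp_pos _, by rw [Real.exp_lt_one_iff]; linarith⟩
  rw [one_div, ← Real.exp_neg, neg_neg, Real.log_exp] at this
  have e : L * (K - D) = |C| + 1 := div_mul_cancel₀ _ hp.ne'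
  linarith [le_abs_self C]
lemma fc_deriv (f f' : ℝ → ℝ) (h1 : ∀ t, HasDerivAt f (f' t) t) (hc : Continuous f')
    (hp : Function.Periodic f (2*π)) (hab : -π < π) (n : ℤ) :
    fourierCoeffOn hab (fun t => (f' t : ℂ)) n
      = Complex.I * n * fourierCoeffOn hab (fun t => (f t : ℂ)) n := by
  have e : f π = f (-π) := by
    have := hp (-π)
    rw [← this]; congr 1; ring
  by_cases hn : n = 0
  · subst hn
    rw [fourierCoeffOn_eq_integral]
    simp only [neg_zero, fourier_zero, one_smul, Int.cast_zero, mul_zero, zero_mul]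
    have : ∫ x in (-π)..π, ((f' x : ℝ) : ℂ) = 0 := by
      rw [intervalIntegral.integral_ofReal,
        intervalIntegral.integral_eq_sub_of_hasDerivAt (fun t _ => h1 t) (hc.intervalIntegrable _ _), e]
      simp
    rw [this]; simp
  · rw [fourierCoeffOn_of_hasDerivAt hab (f := fun t => (f t : ℂ)) (f' := fun t => (f' t : ℂ)) hn
      (fun t _ => (h1 t).ofReal_comp)
      ((Complex.continuous_ofReal.comp hc).intervalIntegrable _ _)]
    rw [e]
    have h2 : (n : ℂ) ≠ 0 := by exact_mod_cast hn
    have h3 : (π : ℂ) ≠ 0 := by exact_mod_cast Real.pi_ne_zero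
    have h4 := Complex.I_ne_zero
    field_simp
    push_cast
    ring

lemma pars (f : ℝ → ℝ) (hc : Continuous f) (hab : -π < π) :
    HasSum (fun i => ‖fourierCoeffOn hab (fun t => (f t : ℂ)) i‖ ^ 2)
      ((π - -π)⁻¹ * ∫ x in (-π)..π, f x ^ 2) := by
  have := hasSum_sq_fourierCoeffOn (f := fun t => (f t : ℂ)) hab (by
    have hc' : Continuous (fun t => (f t : ℂ)) := Complex.continuous_ofReal.comp hc
    obtain ⟨B, hB⟩ := (isCompact_Icc (a := -π) (b := π)).exists_bound_of_continuousOn hc'.continuousOn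
    refine MemLp.of_bound hc'.aestronglyMeasurable B ?_
    exact (ae_restrict_iff' measurableSet_Ioc).2
      (Eventually.of_forall fun t ht => hB t (Set.Ioc_subset_Icc_self ht)))
  simpa using this

lemma wirt (f f' f'' : ℝ → ℝ) (h1 : ∀ t, HasDerivAt f (f' t) t)
    (h2 : ∀ t, HasDerivAt f' (f'' t) t) (hc : Continuous f'')
    (hp : Function.Periodic f (2*π)) (hp' : Function.Periodic f' (2*π)) :
    (∫ t in (-π)..π, f' t ^ 2) ≤ (∫ t in (-π)..π, f'' t ^ 2) ∧
    ((∫ t in (-π)..π, f'' t ^ 2) ≤ (∫ t in (-π)..π, f' t ^ 2) →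
      ∃ c a b : ℝ, ∀ t, f t = c + a * cos t + b * sin t) := by
  have hab : -π < π := by linarith [Real.pi_pos]
  have hT : Fact (0 < π - -π) := ⟨by linarith [Real.pi_pos]⟩
  have hfc : Continuous f := continuous_iff_continuousAt.2 fun t => (h1 t).continuousAt
  have hfc' : Continuous f' := continuous_iff_continuousAt.2 fun t => (h2 t).continuousAt
  have d1 := fc_deriv f f' h1 hfc' hp hab
  have d2 := fc_deriv f' f'' h2 hc hp' hab
  have p1 := pars f' hfc' hab
  have p2 := pars f'' hc hab
  have d3 : ∀ n, ‖fourierCoeffOn hab (fun t => (f'' t : ℂ)) n‖^2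
      = (n:ℝ)^2 * ‖fourierCoeffOn hab (fun t => (f' t : ℂ)) n‖^2 := by
    intro n; rw [d2]; simp [mul_pow]
  have sq : ∀ n : ℤ, n ≠ 0 → (1:ℝ) ≤ (n:ℝ)^2 := by
    intro n hn
    have : (1:ℤ) ≤ n^2 := by have := sq_pos_of_ne_zero (pow_ne_zero 1 hn); simp at this; nlinarith [sq_abs n, Int.one_le_abs hn]
    exact_mod_cast this
  have nn : ∀ n : ℤ, 0 ≤ ‖fourierCoeffOn hab (fun t => (f'' t : ℂ)) n‖^2 - ‖fourierCoeffOn hab (fun t => (f' t : ℂ)) n‖^2 := by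
    intro n
    rw [d3]
    by_cases hn : n = 0
    · rw [d1]; simp [hn]
    · nlinarith [sq n hn, sq_nonneg ‖fourierCoeffOn hab (fun t => (f' t : ℂ)) n‖]
  have hs := p2.sub p1
  have hpos : 0 < (π - -π)⁻¹ := inv_pos.2 hT.out
  have h0 := hs.nonneg nn
  rw [← mul_sub] at h0 hs
  have h0' := nonneg_of_mul_nonneg_right h0 hpos
  refine ⟨by linarith, fun hle => ?_⟩
  have heq : (∫ t in (-π)..π, f'' t ^ 2) - (∫ t in (-π)..π, f' t ^ 2) = 0 := by linarith
  rw [heq, mul_zero] at hs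
  have hz := (hasSum_zero_iff_of_nonneg nn).1 hs
  have cz : ∀ n : ℤ, n ∉ ({0, 1, -1} : Finset ℤ) → fourierCoeffOn hab (fun t => (f t : ℂ)) n = 0 := by
    intro n hn
    simp only [Finset.mem_insert, Finset.mem_singleton, not_or] at hn
    have := congrFun hz n
    simp only [Pi.zero_apply] at this
    rw [d3, d1] at this
    simp only [norm_mul, Complex.norm_I, one_mul, mul_pow, Complex.norm_intCast, sq_abs] at this
    have h4 : ((n:ℝ)^2 - 1) * (n:ℝ)^2 * ‖fourierCoeffOn hab (fun t => (f t : ℂ)) n‖^2 = 0 := by linarith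
    have h5 : (n:ℝ) ≠ 0 := by exact_mod_cast hn.1
    have h6 : (n:ℝ)^2 - 1 ≠ 0 := by
      have : (n^2 - 1 : ℤ) ≠ 0 := by
        intro h
        have : (n-1)*(n+1) = 0 := by linarith
        rcases mul_eq_zero.1 this with h | h
        · exact hn.2.1 (by linarith)
        · exact hn.2.2 (by linarith)
      exact_mod_cast this
    simpa [h5, h6] using h4
  have hpc : Function.Periodic (fun t => (f t : ℂ)) (π - -π) := by
    intro t
    have := hp t
    simp only
    rw [← this]; congr 2; ring
  let F : C(AddCircle (π - -π), ℂ) := ⟨hpc.lift, by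
    apply continuous_coinduced_dom.2
    exact Complex.continuous_ofReal.comp hfc⟩
  have hF : ∀ n, fourierCoeff F n = fourierCoeffOn hab (fun t => (f t : ℂ)) n := by
    intro n
    rw [fourierCoeffOn_eq_integral, fourierCoeff_eq_intervalIntegral _ _ (-π)]
    congr 2
    ring
  have cz' : ∀ n : ℤ, n ∉ ({0, 1, -1} : Finset ℤ) → fourierCoeff F n = 0 := fun n hn => by
    rw [hF, cz n hn]
  have hsm : Summable (fourierCoeff F) := summable_of_ne_finset_zero (s := {0,1,-1}) cz'
  set c := fourierCoeff F
  refine ⟨(c 0).re, (c 1).re + (c (-1)).re, - (c 1).im + (c (-1)).im, fun t => ?_⟩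
  have k1 := has_pointwise_sum_fourier_series_of_summable hsm (t : AddCircle (π - -π))
  have k2 := hasSum_sum_of_ne_finset_zero (L := SummationFilter.unconditional ℤ) (f := fun i => c i • fourier i (t : AddCircle (π - -π)))
    (s := {0,1,-1}) (fun n hn => by simp only [cz' n hn, c, zero_smul])
  have k3 := k1.unique k2
  have k4 : F (t : AddCircle (π - -π)) = (f t : ℂ) := rfl
  rw [k4] at k3
  have ex : ∀ n : ℤ, fourier n (t : AddCircle (π - -π)) = Complex.exp (((n * t : ℝ) : ℂ) * Complex.I) := by
    intro n
    rw [fourier_coe_apply]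
    congr 1
    have h3 : (π : ℂ) ≠ 0 := by exact_mod_cast Real.pi_ne_zero
    push_cast
    rw [div_eq_iff]
    · ring
    · intro h; apply h3; linear_combination h/2
  simp only [ex] at k3
  have k5 := congrArg Complex.re k3
  rw [Finset.sum_insert (by decide), Finset.sum_insert (by decide), Finset.sum_singleton] at k5
  simp only [smul_eq_mul, Complex.add_re, Complex.mul_re, Complex.exp_ofReal_mul_I_re, Complex.exp_ofReal_mul_I_im, Complex.ofReal_re] at k5
  rw [k5]
  simp
  ring

lemma rot_exists (Δ s : ℝ) (hΔ : Δ ≠ 0) (hs : s ≠ 0) (a b c : Fin 3 → ℝ)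
    (haa : ∑ i, a i * a i = s ^ 2) (hbb : ∑ i, b i * b i = s ^ 2) (hcc : ∑ i, c i * c i = Δ ^ 2)
    (hab : ∑ i, a i * b i = 0) (hca : ∑ i, c i * a i = 0) (hcb : ∑ i, c i * b i = 0) :
    ∃ R : E3 ≃ₗᵢ[ℝ] E3, ∀ w : E3, ∀ i, R w i = w 0 * (a i / s) + w 1 * (b i / s) + w 2 * (c i / Δ) := by
  let v : Fin 3 → E3 := ![WithLp.toLp 2 (fun i => a i / s), WithLp.toLp 2 (fun i => b i / s),
    WithLp.toLp 2 (fun i => c i / Δ)]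
  simp only [Fin.sum_univ_three] at haa hbb hcc hab hca hcb
  have hv : Orthonormal ℝ v := by
    rw [orthonormal_iff_ite]
    intro i j
    have hin : inner ℝ (v i) (v j) = ∑ k, v i k * v j k := by
      rw [PiLp.inner_apply]
      exact Finset.sum_congr rfl fun k _ => mul_comm _ _
    rw [hin]
    fin_cases i <;> fin_cases j <;>
      simp [v, Fin.sum_univ_three] <;> field_simp <;> linarith
  have hcard : Fintype.card (Fin 3) = Module.finrank ℝ E3 := by simp
  have hsp : ⊤ ≤ Submodule.span ℝ (Set.range v) := by
    rw [hv.linearIndependent.span_eq_top_of_card_eq_finrank hcard]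
  let B := OrthonormalBasis.mk hv hsp
  refine ⟨B.repr.symm, fun w i => ?_⟩
  rw [← B.sum_repr_symm]
  have : ⇑B = v := OrthonormalBasis.coe_mk hv hsp
  rw [this]
  simp [Fin.sum_univ_three, v]

lemma ev_surj (x : E2) : ∃ t, x = ev ‖x‖ t := by
  let z : ℂ := ⟨x 0, x 1⟩
  have hz : ‖z‖ = ‖x‖ := by
    rw [EuclideanSpace.norm_eq, Complex.norm_eq_sqrt_sq_add_sq]
    simp [z, Fin.sum_univ_two]
  refine ⟨z.arg, ?_⟩
  ext i
  fin_cases i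
  · simpa [z, hz] using (Complex.norm_mul_cos_arg z).symm
  · simpa [z, hz] using (Complex.norm_mul_sin_arg z).symm

theorem stmt_15 (Δ : ℝ) (hΔ0 : 0 < Δ) (hΔ1 : Δ < 1) (y : E2 → E3)
    (hy : ContDiffOn ℝ 2 y {(0 : E2)}ᶜ)
    (hom : ∀ t : ℝ, 0 < t → ∀ x : E2, x ≠ 0 → y (t • x) = t • y x)
    (hiso : ∀ x : E2, x ≠ 0 → gmet y x = gDelta Δ x)
    (C : ℝ)
    (hbend : ∀ ρ ∈ Set.Ioo (0 : ℝ) 1,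
      ∫ x in ball (0 : E2) 1 \ ball 0 ρ, hessNormSq y x ≤
        2 * π * Δ ^ 2 * Real.log (1 / ρ) + C) :
    ∃ R : E3 ≃ₗᵢ[ℝ] E3, ∃ b : E3, ∀ x : E2, x ≠ 0 → y x = R (coneMap Δ x) + b := by
  set f : Fin 3 → E2 → ℝ := fun i z => y z i with hfdef
  have hf : ∀ i, ContDiffOn ℝ 2 (f i) {(0 : E2)}ᶜ := fun i => (contDiffOn_euclidean.1 hy) i
  have hhom : ∀ i, ∀ t : ℝ, 0 < t → ∀ x : E2, x ≠ 0 → f i (t • x) = t * f i x := by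
    intro i t ht x hx
    simp only [hfdef, hom t ht x hx, PiLp.smul_apply, smul_eq_mul]
  have hs2 : 0 < 1 - Δ ^ 2 := by nlinarith
  -- metric on the unit circle
  have hG : ∀ t, (∑ i, pd 0 (f i) (ev 1 t) * pd 0 (f i) (ev 1 t) = 1 - Δ^2 * sin t ^ 2) ∧
      (∑ i, pd 0 (f i) (ev 1 t) * pd 1 (f i) (ev 1 t) = Δ^2 * (sin t * cos t)) ∧
      (∑ i, pd 1 (f i) (ev 1 t) * pd 1 (f i) (ev 1 t) = 1 - Δ^2 * cos t ^ 2) := by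
    intro t
    have h := hiso (ev 1 t) (ev_ne 1 t one_pos)
    have key : ∀ j k, (∑ i, pd j (f i) (ev 1 t) * pd k (f i) (ev 1 t)) = gDelta Δ (ev 1 t) j k := by
      intro j k
      rw [← h]; simp only [gmet, Dmat, Matrix.mul_apply, Matrix.transpose_apply, Matrix.of_apply, hfdef]
    refine ⟨?_, ?_, ?_⟩ <;> rw [key] <;>
      simp [gDelta, perpVec, ev_norm 1 t zero_le_one] <;> ring
  have hn : ∀ t, ∑ i, f i (ev 1 t) ^ 2 = 1 := by
    intro t
    obtain ⟨g0, g1, g2⟩ := hG t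
    have e : ∀ i, f i (ev 1 t) = cos t * pd 0 (f i) (ev 1 t) + sin t * pd 1 (f i) (ev 1 t) := by
      intro i
      have := euler (f i) (hf i) (hhom i) (ev 1 t) (ev_ne 1 t one_pos)
      simp only [ev_zero, ev_one, one_mul] at this
      exact this.symm
    simp only [e]
    simp only [Fin.sum_univ_three] at *
    linear_combination cos t ^ 2 * g0 + 2 * sin t * cos t * g1 + sin t ^ 2 * g2 + sin_sq_add_cos_sq t
  have hd : ∀ t, ∑ i, D1 (f i) 1 t ^ 2 = 1 - Δ ^ 2 := by
    intro t
    obtain ⟨g0, g1, g2⟩ := hG t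
    simp only [D1]
    simp only [Fin.sum_univ_three] at *
    linear_combination sin t ^ 2 * g0 - 2 * sin t * cos t * g1 + cos t ^ 2 * g2
      + (1 - Δ^2 * (sin t ^ 2 + cos t ^2 + 1)) * sin_sq_add_cos_sq t
  have hD1' := fun i t => hD1 (f i) (hf i) 1 t one_pos
  have hD2' := fun i t => hD2 (f i) (hf i) (hhom i) 1 t one_pos
  have hc0 : ∀ i, Continuous fun t => f i (ev 1 t) := fun i =>
    continuous_iff_continuousAt.2 fun t => (hD1' i t).continuousAt
  have hc1 : ∀ i, Continuous (D1 (f i) 1) := fun i =>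
    continuous_iff_continuousAt.2 fun t => (hD2' i t).continuousAt
  have hc2 : ∀ i, Continuous (D2 (f i) 1) := fun i => D2_cont (f i) (hf i)
  have hq1 : ∀ i, Continuous fun t => D1 (f i) 1 t ^ 2 := fun i => (hc1 i).pow 2
  have hq2 : ∀ i, Continuous fun t => D2 (f i) 1 t ^ 2 := fun i => (hc2 i).pow 2
  have hfd : ∀ t, ∑ i, f i (ev 1 t) * D1 (f i) 1 t = 0 := by
    intro t
    have h1 := HasDerivAt.fun_sum (u := Finset.univ) (fun i _ => (hD1' i t).pow 2)
    have h2 : HasDerivAt (fun t => ∑ i, f i (ev 1 t) ^ 2) 0 t := by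
      simp only [hn]; exact hasDerivAt_const t 1
    have h3 := h1.unique h2
    simp only [Fin.sum_univ_three] at *
    norm_num at h3
    linarith
  have hff : ∀ t, ∑ i, f i (ev 1 t) * D2 (f i) 1 t = -(1 - Δ^2) := by
    intro t
    have h1 := HasDerivAt.fun_sum (u := Finset.univ) (fun i _ => (hD1' i t).mul (hD2' i t))
    have h2 : HasDerivAt (fun t => ∑ i, f i (ev 1 t) * D1 (f i) 1 t) 0 t := by
      simp only [hfd]; exact hasDerivAt_const t 0
    have h3 := h1.unique h2
    have h4 := hd t
    simp only [Fin.sum_univ_three] at *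
    linarith
  -- energy
  have hK : ∫ t in (-π)..π, (∑ i, (f i (ev 1 t) + D2 (f i) 1 t) ^ 2) ≤ 2 * π * Δ ^ 2 := by
    refine log_bound _ _ C fun ρ hρ => ?_
    refine le_trans (polar_bound (hessNormSq y) ?_ _ ?_ ?_ ρ hρ) (hbend ρ hρ)
    · unfold hessNormSq frob2
      refine continuousOn_finsetSum _ fun i _ => continuousOn_finsetSum _ fun j _ =>
        continuousOn_finsetSum _ fun k _ => (hess_cont (f i) (hf i) j k).pow 2
    · exact continuous_finsetSum _ fun i _ => ((hc0 i).add (hc2 i)).pow 2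
    · intro r t hr
      rw [Finset.sum_div, hessNormSq, Finset.mul_sum]
      exact Finset.sum_le_sum fun i _ => key_bound (f i) (hf i) (hhom i) r t hr
  have e1 : ∀ t, (∑ i, (f i (ev 1 t) + D2 (f i) 1 t) ^ 2)
      = (1 - 2 * (1 - Δ^2)) + ∑ i, D2 (f i) 1 t ^ 2 := by
    intro t
    have h1 := hn t
    have h2 := hff t
    simp only [Fin.sum_univ_three] at *
    linear_combination h1 + 2 * h2
  simp only [e1] at hK
  rw [intervalIntegral.integral_add (continuous_const.intervalIntegrable _ _)
    ((continuous_finsetSum _ fun i _ => hq2 i).intervalIntegrable _ _),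
    intervalIntegral.integral_const, intervalIntegral.integral_finsetSum
      (fun i _ => (hq2 i).intervalIntegrable _ _)] at hK
  have hK1 : ∑ i, ∫ t in (-π)..π, D1 (f i) 1 t ^ 2 = 2 * π * (1 - Δ^2) := by
    rw [← intervalIntegral.integral_finsetSum
      (fun i _ => (hq1 i).intervalIntegrable _ _)]
    simp only [hd, intervalIntegral.integral_const, smul_eq_mul]
    ring
  have hK2 : ∑ i, ∫ t in (-π)..π, D2 (f i) 1 t ^ 2 ≤ ∑ i, ∫ t in (-π)..π, D1 (f i) 1 t ^ 2 := by
    rw [hK1]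
    simp only [smul_eq_mul] at hK
    linarith
  have evp : ∀ t, ev 1 (t + 2 * π) = ev 1 t := by intro t; simp [ev]
  have hW := fun i => wirt (fun t => f i (ev 1 t)) (D1 (f i) 1) (D2 (f i) 1) (hD1' i) (hD2' i) (hc2 i)
    (by intro t; simp only [evp]) (by intro t; simp only [D1, evp, sin_add_two_pi, cos_add_two_pi])
  have hle : ∀ i, (∫ t in (-π)..π, D2 (f i) 1 t ^ 2) ≤ ∫ t in (-π)..π, D1 (f i) 1 t ^ 2 := by
    have a0 := (hW 0).1
    have a1 := (hW 1).1
    have a2 := (hW 2).1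
    simp only [Fin.sum_univ_three] at hK2
    intro i
    fin_cases i
    · show (∫ t in (-π)..π, D2 (f 0) 1 t ^ 2) ≤ ∫ t in (-π)..π, D1 (f 0) 1 t ^ 2
      linarith
    · show (∫ t in (-π)..π, D2 (f 1) 1 t ^ 2) ≤ ∫ t in (-π)..π, D1 (f 1) 1 t ^ 2
      linarith
    · show (∫ t in (-π)..π, D2 (f 2) 1 t ^ 2) ≤ ∫ t in (-π)..π, D1 (f 2) 1 t ^ 2
      linarith
  choose c a b habc using fun i => (hW i).2 (hle i)
  have hder : ∀ i t, D1 (f i) 1 t = - a i * sin t + b i * cos t := by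
    intro i t
    have h1 := hD1' i t
    rw [show (fun t => f i (ev 1 t)) = fun t => c i + a i * cos t + b i * sin t from funext (habc i)] at h1
    have h2 := (((hasDerivAt_cos t).const_mul (a i)).const_add (c i)).add ((hasDerivAt_sin t).const_mul (b i))
    rw [h1.unique h2]; ring
  simp only [hder] at hd
  simp only [habc] at hn
  have n0 := hn 0
  have n1 := hn (π/2)
  have n2 := hn π
  have n3 := hn (-(π/2))
  have m0 := hd 0
  have m1 := hd (π/2)
  have m2 := hd (π/4)
  simp only [sin_zero, cos_zero, sin_pi_div_two, cos_pi_div_two, sin_pi, cos_pi, sin_neg, cos_neg,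
    sin_pi_div_four, cos_pi_div_four, Fin.sum_univ_three] at n0 n1 n2 n3 m0 m1 m2
  have s2 : √(2:ℝ) ^ 2 = 2 := Real.sq_sqrt (by norm_num)
  have s1 : √(1 - Δ^2) ^ 2 = 1 - Δ^2 := Real.sq_sqrt hs2.le
  have s0 : √(1 - Δ^2) ≠ 0 := (Real.sqrt_pos.2 hs2).ne'
  obtain ⟨R, hR⟩ := rot_exists Δ (√(1 - Δ^2)) hΔ0.ne' s0 a b c
    (by rw [s1, Fin.sum_univ_three]; linarith) (by rw [s1, Fin.sum_univ_three]; linarith)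
    (by rw [Fin.sum_univ_three]; linarith)
    (by
      rw [Fin.sum_univ_three]
      have : √(2:ℝ)^2/4 * ((b 0 - a 0)^2 + (b 1 - a 1)^2 + (b 2 - a 2)^2) = 1 - Δ^2 := by
        rw [← m2]; ring
      rw [s2] at this
      linarith)
    (by rw [Fin.sum_univ_three]; linarith) (by rw [Fin.sum_univ_three]; linarith)
  refine ⟨R, 0, fun x hx => ?_⟩
  obtain ⟨t, ht⟩ := ev_surj x
  have hxn : 0 < ‖x‖ := norm_pos_iff.2 hx
  ext i
  have h1 : y x i = ‖x‖ * (c i + a i * cos t + b i * sin t) := by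
    rw [← habc, ← hom_ev (f i) (hhom i) _ t hxn, ← ht]
  have x0 : x 0 = ‖x‖ * cos t := (congrArg (fun z : E2 => z _) ht).trans rfl
  have x1 : x 1 = ‖x‖ * sin t := (congrArg (fun z : E2 => z _) ht).trans rfl
  have w0 : coneMap Δ x 0 = √(1 - Δ^2) * x 0 := rfl
  have w1 : coneMap Δ x 1 = √(1 - Δ^2) * x 1 := rfl
  have w2 : coneMap Δ x 2 = Δ * ‖x‖ := rfl
  rw [add_zero, hR, h1, w0, w1, w2, x0, x1]
  field_simp
  ring
end
end
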